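/- arXiv:0705.1587 — 2 statements merged into one kernel-verified Lean document; each statement's English description precedes it below -/
import Mathlib

section
/- Hydrogen ground state bound: for any z > 0 and any f ∈ H^1(ℝ³), ∫ |∇f(x)|² dx - z ∫ |f(x)|²/|x| dx ≥ -(z²/4) ∫ |f(x)|² dx. -/
open MeasureTheory

noncomputable section

abbrev E3 := EuclideanSpace ℝ (Fin 3)

open Filter Topology

/-- The Fréchet derivative of the `i`-th coordinate of the smoothed radial field
`x ↦ x / √(‖x‖² + ε)`. -/
lemma hasFDerivAt_coord_div_sqrt {ι : Type*} [Fintype ι] {ε : ℝ} (hε : 0 < ε) (i : ι)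
    (x : EuclideanSpace ℝ ι) :
    HasFDerivAt (fun y : EuclideanSpace ℝ ι => y i / √(‖y‖ ^ 2 + ε))
      ((√(‖x‖ ^ 2 + ε))⁻¹ • (EuclideanSpace.proj i : EuclideanSpace ℝ ι →L[ℝ] ℝ) -
        (x i / √(‖x‖ ^ 2 + ε) ^ 3) • innerSL ℝ x) x := by
  have hpos : 0 < ‖x‖ ^ 2 + ε := by positivity
  have hsqrt : 0 < √(‖x‖ ^ 2 + ε) := Real.sqrt_pos.mpr hpos
  have hs := (((hasStrictFDerivAt_norm_sq x).hasFDerivAt.add_const ε).sqrt hpos.ne')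
  have hp := (EuclideanSpace.proj i : EuclideanSpace ℝ ι →L[ℝ] ℝ).hasFDerivAt (x := x)
  have hinv := (hasDerivAt_inv hsqrt.ne').comp_hasFDerivAt x hs
  refine (hp.mul hinv).congr_fderiv ?_
  ext v
  simp
  field_simp
  ring

/-- The diagonal partial derivatives of the smoothed radial field. -/
lemma fderiv_coord_div_sqrt_single {ι : Type*} [Fintype ι] [DecidableEq ι] {ε : ℝ} (hε : 0 < ε)
    (i : ι) (x : EuclideanSpace ℝ ι) :
    fderiv ℝ (fun y : EuclideanSpace ℝ ι => y i / √(‖y‖ ^ 2 + ε)) x (EuclideanSpace.single i 1) =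
      (√(‖x‖ ^ 2 + ε))⁻¹ - x i ^ 2 / √(‖x‖ ^ 2 + ε) ^ 3 := by
  rw [(hasFDerivAt_coord_div_sqrt hε i x).fderiv]
  simp [EuclideanSpace.inner_single_right]
  ring

lemma abs_fderiv_coord_div_sqrt_single_le {ι : Type*} [Fintype ι] [DecidableEq ι] {ε : ℝ}
    (hε : 0 < ε) (i : ι) (x : EuclideanSpace ℝ ι) :
    |fderiv ℝ (fun y : EuclideanSpace ℝ ι => y i / √(‖y‖ ^ 2 + ε)) x
      (EuclideanSpace.single i 1)| ≤ (√ε)⁻¹ := by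
  rw [fderiv_coord_div_sqrt_single hε]
  have hpos : 0 < ‖x‖ ^ 2 + ε := by positivity
  have hs : 0 < √(‖x‖ ^ 2 + ε) := Real.sqrt_pos.mpr hpos
  have hxi : x i ^ 2 ≤ √(‖x‖ ^ 2 + ε) ^ 2 := by
    rw [Real.sq_sqrt hpos.le, ← sq_abs, ← Real.norm_eq_abs]
    have := PiLp.norm_apply_le x i
    nlinarith [norm_nonneg (x i)]
  have hq : x i ^ 2 / √(‖x‖ ^ 2 + ε) ^ 3 ≤ (√(‖x‖ ^ 2 + ε))⁻¹ := by
    rw [div_le_iff₀ (by positivity)]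
    calc x i ^ 2 ≤ √(‖x‖ ^ 2 + ε) ^ 2 := hxi
      _ = _ := by field_simp
  have hinv : (√(‖x‖ ^ 2 + ε))⁻¹ ≤ (√ε)⁻¹ := by
    gcongr
    linarith [sq_nonneg ‖x‖]
  rw [abs_of_nonneg (by linarith)]
  have : 0 ≤ x i ^ 2 / √(‖x‖ ^ 2 + ε) ^ 3 := by positivity
  linarith

lemma abs_coord_div_sqrt_le_one {ι : Type*} [Fintype ι] {ε : ℝ} (hε : 0 < ε) (i : ι)
    (x : EuclideanSpace ℝ ι) : |x i / √(‖x‖ ^ 2 + ε)| ≤ 1 := by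
  have hs : 0 < √(‖x‖ ^ 2 + ε) := Real.sqrt_pos.mpr (by positivity)
  rw [abs_div, abs_of_pos hs, div_le_one hs]
  refine (PiLp.norm_apply_le x i).trans (Real.le_sqrt_of_sq_le ?_)
  linarith

/-- The smoothed radial field on `ℝ³` has divergence at least `2 / √(‖x‖² + ε)`. -/
lemma two_div_sqrt_le_divergence {ε : ℝ} (hε : 0 < ε) (x : E3) :
    2 / √(‖x‖ ^ 2 + ε) ≤ ∑ i, fderiv ℝ (fun y : E3 => y i / √(‖y‖ ^ 2 + ε)) x
      (EuclideanSpace.single i 1) := by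
  have hpos : 0 < ‖x‖ ^ 2 + ε := by positivity
  have hs : 0 < √(‖x‖ ^ 2 + ε) := Real.sqrt_pos.mpr hpos
  simp_rw [fderiv_coord_div_sqrt_single hε]
  rw [Finset.sum_sub_distrib, ← Finset.sum_div, ← EuclideanSpace.real_norm_sq_eq]
  have hq : ‖x‖ ^ 2 / √(‖x‖ ^ 2 + ε) ^ 3 ≤ (√(‖x‖ ^ 2 + ε))⁻¹ := by
    rw [div_le_iff₀ (by positivity)]
    calc ‖x‖ ^ 2 ≤ √(‖x‖ ^ 2 + ε) ^ 2 := by rw [Real.sq_sqrt hpos.le]; linarith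
      _ = _ := by field_simp
  simp only [Finset.sum_const, Finset.card_univ, Fintype.card_fin, nsmul_eq_mul, Nat.cast_ofNat]
  rw [div_eq_mul_inv]
  linarith

/-- The divergence theorem for the field `x ↦ (g x / √(‖x‖² + ε)) • x` on all of `ℝ³`. -/
lemma integral_fderiv_smoothed_radial {ε : ℝ} (hε : 0 < ε) {g : E3 → ℝ}
    (hg : Differentiable ℝ g) (hgi : Integrable g) (hg' : Integrable (fderiv ℝ g)) :
    Integrable (fun x => fderiv ℝ g x ((√(‖x‖ ^ 2 + ε))⁻¹ • x)) ∧
    Integrable (fun x => (∑ i, fderiv ℝ (fun y : E3 => y i / √(‖y‖ ^ 2 + ε)) x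
      (EuclideanSpace.single i 1)) * g x) ∧
    ∫ x, fderiv ℝ g x ((√(‖x‖ ^ 2 + ε))⁻¹ • x) =
      -∫ x, (∑ i, fderiv ℝ (fun y : E3 => y i / √(‖y‖ ^ 2 + ε)) x
        (EuclideanSpace.single i 1)) * g x := by
  have hudiff (i : Fin 3) : Differentiable ℝ (fun y : E3 => y i / √(‖y‖ ^ 2 + ε)) :=
    fun x => (hasFDerivAt_coord_div_sqrt hε i x).differentiableAt
  have hexpand (x : E3) : fderiv ℝ g x ((√(‖x‖ ^ 2 + ε))⁻¹ • x) =
      ∑ i, x i / √(‖x‖ ^ 2 + ε) * fderiv ℝ g x (EuclideanSpace.single i 1) := by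
    have hx : x = ∑ i, x i • EuclideanSpace.single i (1 : ℝ) := by
      simpa using ((EuclideanSpace.basisFun (Fin 3) ℝ).sum_repr x).symm
    have hgx := congrArg (fderiv ℝ g x) hx
    rw [map_sum] at hgx
    rw [map_smul, hgx, Finset.smul_sum]
    refine Finset.sum_congr rfl fun i _ => ?_
    simp only [map_smul, smul_eq_mul]
    ring
  have hint1 (i : Fin 3) : Integrable
      (fun x : E3 => x i / √(‖x‖ ^ 2 + ε) * fderiv ℝ g x (EuclideanSpace.single i 1)) :=
    (hg'.apply_continuousLinearMap _).bdd_mul (hudiff i).continuous.aestronglyMeasurable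
      (ae_of_all _ (abs_coord_div_sqrt_le_one hε i))
  have hint2 (i : Fin 3) : Integrable (fun x => fderiv ℝ (fun y : E3 => y i / √(‖y‖ ^ 2 + ε)) x
      (EuclideanSpace.single i 1) * g x) :=
    hgi.bdd_mul (measurable_fderiv_apply_const ℝ _ _).aestronglyMeasurable
      (ae_of_all _ (abs_fderiv_coord_div_sqrt_single_le hε i))
  have hint3 (i : Fin 3) : Integrable (fun x : E3 => x i / √(‖x‖ ^ 2 + ε) * g x) :=
    hgi.bdd_mul (hudiff i).continuous.aestronglyMeasurable
      (ae_of_all _ (abs_coord_div_sqrt_le_one hε i))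
  simp_rw [hexpand, Finset.sum_mul]
  refine ⟨integrable_finsetSum _ fun i _ => hint1 i, integrable_finsetSum _ fun i _ => hint2 i, ?_⟩
  rw [integral_finsetSum _ fun i _ => hint1 i, integral_finsetSum _ fun i _ => hint2 i,
    ← Finset.sum_neg_distrib]
  exact Finset.sum_congr rfl fun i _ => integral_mul_fderiv_eq_neg_fderiv_mul_of_integrable
    (hint2 i) (hint1 i) (hint3 i) (fun x _ => hudiff i x) (fun x _ => hg x)

lemma integrable_fderiv_norm_sq {f : E3 → ℂ} (hdiff : Differentiable ℝ f)
    (hf2 : Integrable (fun x => ‖f x‖ ^ 2)) (hgrad : Integrable (fun x => ‖fderiv ℝ f x‖ ^ 2)) :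
    Integrable (fderiv ℝ fun x => ‖f x‖ ^ 2) := by
  refine (hf2.add hgrad).mono' (measurable_fderiv ℝ _).aestronglyMeasurable (ae_of_all _ fun x => ?_)
  refine ContinuousLinearMap.opNorm_le_bound _ (by simp; positivity) fun v => ?_
  rw [(hdiff x).hasFDerivAt.norm_sq.fderiv]
  have h1 := norm_inner_le_norm (𝕜 := ℝ) (f x) (fderiv ℝ f x v)
  have h2 := (fderiv ℝ f x).le_opNorm v
  simp only [smul_apply, ContinuousLinearMap.comp_apply, innerSL_apply_apply,
    Pi.add_apply, nsmul_eq_mul, norm_mul, Nat.cast_ofNat, Real.norm_ofNat]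
  calc 2 * ‖inner ℝ (f x) (fderiv ℝ f x v)‖ ≤ 2 * (‖f x‖ * (‖fderiv ℝ f x‖ * ‖v‖)) := by
        gcongr
        exact h1.trans (mul_le_mul_of_nonneg_left h2 (norm_nonneg _))
    _ = (2 * ‖f x‖ * ‖fderiv ℝ f x‖) * ‖v‖ := by ring
    _ ≤ _ := by
        gcongr
        exact two_mul_le_add_sq _ _

/-- The pointwise completion of the square, for any direction `u` of length at most one. -/
lemma neg_mul_fderiv_norm_sq_le {z : ℝ} (hz : 0 < z) {f : E3 → ℂ} (hdiff : Differentiable ℝ f)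
    (x : E3) {u : E3} (hu : ‖u‖ ≤ 1) :
    -(z / 2 * fderiv ℝ (fun y => ‖f y‖ ^ 2) x u) ≤
      ‖fderiv ℝ f x‖ ^ 2 + z ^ 2 / 4 * ‖f x‖ ^ 2 := by
  rw [(hdiff x).hasFDerivAt.norm_sq.fderiv]
  have h1 := norm_inner_le_norm (𝕜 := ℝ) (f x) (fderiv ℝ f x u)
  have h2 := (fderiv ℝ f x).le_of_opNorm_le_of_le le_rfl hu
  rw [Real.norm_eq_abs] at h1
  have h3 : -inner ℝ (f x) (fderiv ℝ f x u) ≤ ‖f x‖ * ‖fderiv ℝ f x‖ :=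
    (neg_le_abs _).trans (h1.trans (by gcongr; simpa using h2))
  simp only [smul_apply, ContinuousLinearMap.comp_apply, innerSL_apply_apply,
    nsmul_eq_mul, Nat.cast_ofNat]
  nlinarith [sq_nonneg (‖fderiv ℝ f x‖ - z / 2 * ‖f x‖)]

/-- The bound for the smoothed Coulomb potential `-z / √(‖x‖² + ε)`. -/
lemma smoothed_coulomb_bound {z ε : ℝ} (hz : 0 < z) (hε : 0 < ε) {f : E3 → ℂ}
    (hdiff : Differentiable ℝ f)
    (hf2 : Integrable (fun x => ‖f x‖ ^ 2))
    (hgrad : Integrable (fun x => ‖fderiv ℝ f x‖ ^ 2)) :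
    z * ∫ x : E3, ‖f x‖ ^ 2 / √(‖x‖ ^ 2 + ε) ≤
      (∫ x : E3, ‖fderiv ℝ f x‖ ^ 2) + z ^ 2 / 4 * ∫ x : E3, ‖f x‖ ^ 2 := by
  obtain ⟨hrad, hdiv, heq⟩ := integral_fderiv_smoothed_radial hε (hdiff.norm_sq ℝ) hf2
    (integrable_fderiv_norm_sq hdiff hf2 hgrad)
  calc z * ∫ x : E3, ‖f x‖ ^ 2 / √(‖x‖ ^ 2 + ε)
      = z / 2 * ∫ x : E3, 2 / √(‖x‖ ^ 2 + ε) * ‖f x‖ ^ 2 := by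
        rw [← integral_const_mul, ← integral_const_mul]
        congr 1 with x
        ring
    _ ≤ z / 2 * ∫ x : E3, (∑ i, fderiv ℝ (fun y : E3 => y i / √(‖y‖ ^ 2 + ε)) x
          (EuclideanSpace.single i 1)) * ‖f x‖ ^ 2 := by
        refine mul_le_mul_of_nonneg_left ?_ (by positivity)
        refine integral_mono_of_nonneg (ae_of_all _ fun x => by positivity) hdiv
          (ae_of_all _ fun x => ?_)
        exact mul_le_mul_of_nonneg_right (two_div_sqrt_le_divergence hε x) (by positivity)
    _ = ∫ x : E3, -(z / 2 * fderiv ℝ (fun y => ‖f y‖ ^ 2) x ((√(‖x‖ ^ 2 + ε))⁻¹ • x)) := by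
        rw [integral_neg, integral_const_mul, heq]
        ring
    _ ≤ ∫ x : E3, (‖fderiv ℝ f x‖ ^ 2 + z ^ 2 / 4 * ‖f x‖ ^ 2) := by
        refine integral_mono (hrad.const_mul _).neg (hgrad.add (hf2.const_mul _)) fun x =>
          neg_mul_fderiv_norm_sq_le hz hdiff x ?_
        rw [norm_smul, norm_inv, Real.norm_of_nonneg (Real.sqrt_nonneg _)]
        exact inv_mul_le_one_of_le₀ (Real.le_sqrt_of_sq_le (by linarith)) (Real.sqrt_nonneg _)
    _ = _ := by rw [integral_add hgrad (hf2.const_mul _), integral_const_mul]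

lemma tendsto_integral_smoothed_coulomb {f : E3 → ℂ} (hf : Continuous f)
    (hcoul : Integrable (fun x => ‖f x‖ ^ 2 / ‖x‖)) :
    Tendsto (fun ε : ℝ => ∫ x : E3, ‖f x‖ ^ 2 / √(‖x‖ ^ 2 + ε)) (𝓝[>] 0)
      (𝓝 (∫ x : E3, ‖f x‖ ^ 2 / ‖x‖)) := by
  have hne : ∀ᵐ x : E3, x ≠ 0 := Measure.ae_ne volume 0
  refine tendsto_integral_filter_of_dominated_convergence _ ?_ ?_ hcoul ?_
  · filter_upwards with ε
    have : Measurable f := hf.measurable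
    exact Measurable.aestronglyMeasurable (by fun_prop)
  · filter_upwards [self_mem_nhdsWithin] with ε hε
    filter_upwards [hne] with x hx
    have hε : 0 < ε := hε
    have hx : 0 < ‖x‖ := norm_pos_iff.mpr hx
    rw [Real.norm_of_nonneg (by positivity)]
    gcongr
    exact Real.le_sqrt_of_sq_le (by linarith)
  · filter_upwards [hne] with x hx
    have hcont : ContinuousAt (fun ε : ℝ => ‖f x‖ ^ 2 / √(‖x‖ ^ 2 + ε)) 0 := by
      refine ContinuousAt.div (by fun_prop) (by fun_prop) ?_
      simpa using hx
    simpa [ContinuousAt] using hcont.mono_left nhdsWithin_le_nhds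

/-- Hydrogen ground state bound: for `z > 0` and `f ∈ H¹(ℝ³)`,
`∫ |∇f|² - z ∫ |f(x)|²/|x| dx ≥ -(z²/4) ∫ |f|²`. -/
theorem hydrogen_ground_state_bound (z : ℝ) (hz : 0 < z) (f : E3 → ℂ)
    (hdiff : Differentiable ℝ f)
    (hf2 : Integrable (fun x => ‖f x‖ ^ 2))
    (hgrad : Integrable (fun x => ‖fderiv ℝ f x‖ ^ 2))
    (hcoul : Integrable (fun x => ‖f x‖ ^ 2 / ‖x‖)) :
    -(z ^ 2 / 4) * ∫ x : E3, ‖f x‖ ^ 2 ≤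
      (∫ x : E3, ‖fderiv ℝ f x‖ ^ 2) - z * ∫ x : E3, ‖f x‖ ^ 2 / ‖x‖ := by
  have hlim := (tendsto_integral_smoothed_coulomb hdiff.continuous hcoul).const_mul z
  have hle := le_of_tendsto hlim <| by
    filter_upwards [self_mem_nhdsWithin] with ε hε
    exact smoothed_coulomb_bound hz hε hdiff hf2 hgrad
  linarith

end
end

section
/- For any nonnegative trace-class operator γ on L²(ℝ³) with finite kinetic energy and any ε > 0, the exchange energy X(γ^{1/2}) = (1/2)∬ |γ^{1/2}(r,r')|²/|r-r'| dr dr' satisfies X(γ^{1/2}) ≤ (ε/4) Tr(-∇² γ) + (1/(4ε)) Tr γ. -/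
open MeasureTheory

noncomputable section

/-- A nonnegative function integrable on `(0, ∞)` takes arbitrarily small values arbitrarily far. -/
theorem exists_ge_le_of_integrableOn_Ioi {b : ℝ → ℝ} (hb : IntegrableOn b (Set.Ioi 0))
    {δ : ℝ} (hδ : 0 < δ) {N : ℝ} (hN : 0 ≤ N) : ∃ R, N ≤ R ∧ b R ≤ δ := by
  by_contra! h
  have hsub : Set.Ioi N ⊆ Set.Ioi 0 := Set.Ioi_subset_Ioi hN
  have hc : IntegrableOn (fun _ : ℝ => δ) (Set.Ioi N) := by
    refine Integrable.mono' (hb.mono_set hsub) aestronglyMeasurable_const ?_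
    filter_upwards [ae_restrict_mem measurableSet_Ioi] with x hx
    rw [Real.norm_of_nonneg hδ.le]
    exact (h x (le_of_lt hx)).le
  rw [integrableOn_const_iff] at hc
  simp [hδ.ne'] at hc

/-- Completing the square in `‖g' + g / ε‖² ≥ 0`. -/
theorem neg_deriv_half_sq_mul_norm_sq_le {ε : ℝ} (hε : 0 < ε) (ρ : ℝ) (z w : ℂ) :
    -(ρ * ‖z‖ ^ 2 + ρ ^ 2 * inner ℝ z w) ≤
      ε / 2 * (ρ ^ 2 * ‖w‖ ^ 2) + 1 / (2 * ε) * (ρ ^ 2 * ‖z‖ ^ 2) - ρ * ‖z‖ ^ 2 := by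
  have h : 0 ≤ ε / 2 * ρ ^ 2 * ‖w + ε⁻¹ • z‖ ^ 2 := by positivity
  rw [norm_add_sq_real, norm_smul, inner_smul_right, real_inner_comm, mul_pow,
    Real.norm_of_nonneg (by positivity)] at h
  have e : ε / 2 * ρ ^ 2 * (‖w‖ ^ 2 + 2 * (ε⁻¹ * inner ℝ z w) + ε⁻¹ ^ 2 * ‖z‖ ^ 2) =
      ε / 2 * (ρ ^ 2 * ‖w‖ ^ 2) + 1 / (2 * ε) * (ρ ^ 2 * ‖z‖ ^ 2) + ρ ^ 2 * inner ℝ z w := by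
    field_simp
    ring
  rw [e] at h
  linarith

/-- The radial hydrogen bound on a finite interval, with its boundary term. -/
theorem intervalIntegral_mul_norm_sq_le {g : ℝ → ℂ} (hg : Differentiable ℝ g)
    {ε : ℝ} (hε : 0 < ε)
    (ha : IntegrableOn (fun ρ : ℝ => ρ ^ 2 * ‖deriv g ρ‖ ^ 2) (Set.Ioi 0))
    (hb : IntegrableOn (fun ρ : ℝ => ρ ^ 2 * ‖g ρ‖ ^ 2) (Set.Ioi 0)) {R : ℝ} (hR : 0 ≤ R) :
    ∫ ρ in (0 : ℝ)..R, ρ * ‖g ρ‖ ^ 2 ≤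
      (∫ ρ in Set.Ioi (0 : ℝ), (ε / 2 * (ρ ^ 2 * ‖deriv g ρ‖ ^ 2) +
        1 / (2 * ε) * (ρ ^ 2 * ‖g ρ‖ ^ 2))) + R ^ 2 * ‖g R‖ ^ 2 / 2 := by
  have hgc : Continuous g := hg.continuous
  have hab := (ha.const_mul (ε / 2)).add (hb.const_mul (1 / (2 * ε)))
  have hc : Continuous fun ρ : ℝ => ρ * ‖g ρ‖ ^ 2 := by fun_prop
  have habR : IntervalIntegrable (fun ρ : ℝ => ε / 2 * (ρ ^ 2 * ‖deriv g ρ‖ ^ 2) +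
      1 / (2 * ε) * (ρ ^ 2 * ‖g ρ‖ ^ 2)) volume 0 R :=
    (intervalIntegrable_iff_integrableOn_Ioc_of_le hR).2
      (IntegrableOn.mono_set hab Set.Ioc_subset_Ioi_self)
  have hcR : IntervalIntegrable (fun ρ : ℝ => ρ * ‖g ρ‖ ^ 2) volume 0 R :=
    hc.intervalIntegrable _ _
  have hderiv (ρ : ℝ) : HasDerivAt (fun ρ : ℝ => -(ρ ^ 2 * ‖g ρ‖ ^ 2 / 2))
      (-(ρ * ‖g ρ‖ ^ 2 + ρ ^ 2 * inner ℝ (g ρ) (deriv g ρ))) ρ := by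
    have h := (((hasDerivAt_pow 2 ρ).mul (hg ρ).hasDerivAt.norm_sq).div_const 2).neg
    refine h.congr_deriv ?_
    simp
    ring
  have key := intervalIntegral.sub_le_integral_of_hasDeriv_right_of_le hR
    (fun ρ _ => (hderiv ρ).continuousAt.continuousWithinAt)
    (fun ρ _ => (hderiv ρ).hasDerivWithinAt)
    ((intervalIntegrable_iff_integrableOn_Icc_of_le hR).1 (habR.sub hcR))
    (fun ρ _ => neg_deriv_half_sq_mul_norm_sq_le hε ρ (g ρ) (deriv g ρ))
  rw [intervalIntegral.integral_sub habR hcR, intervalIntegral.integral_of_le hR] at key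
  have hmono := setIntegral_mono_set hab
    (Filter.Eventually.of_forall fun ρ => by simp only [Pi.zero_apply, Pi.add_apply]; positivity)
    (Set.Ioc_subset_Ioi_self : Set.Ioc 0 R ⊆ Set.Ioi 0).eventuallyLE
  simp only [Pi.add_apply] at hmono
  norm_num at key hmono ⊢
  linarith

/-- The radial form of the hydrogen bound. -/
theorem lintegral_Ioi_mul_norm_sq_le {g : ℝ → ℂ} (hg : Differentiable ℝ g)
    {ε : ℝ} (hε : 0 < ε) :
    ∫⁻ ρ in Set.Ioi (0 : ℝ), ENNReal.ofReal (ρ * ‖g ρ‖ ^ 2) ≤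
      ENNReal.ofReal (ε / 2) *
          (∫⁻ ρ in Set.Ioi (0 : ℝ), ENNReal.ofReal (ρ ^ 2 * ‖deriv g ρ‖ ^ 2)) +
        ENNReal.ofReal (1 / (2 * ε)) *
          ∫⁻ ρ in Set.Ioi (0 : ℝ), ENNReal.ofReal (ρ ^ 2 * ‖g ρ‖ ^ 2) := by
  have hgc : Continuous g := hg.continuous
  have hgd : Measurable (deriv g) := measurable_deriv g
  have hcε : 0 < ε / 2 := by positivity
  have hcε' : 0 < 1 / (2 * ε) := by positivity
  by_cases hA : ∫⁻ ρ in Set.Ioi (0 : ℝ), ENNReal.ofReal (ρ ^ 2 * ‖deriv g ρ‖ ^ 2) = ⊤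
  · rw [hA, ENNReal.mul_top (by simpa using hcε), top_add]
    exact le_top
  by_cases hB : ∫⁻ ρ in Set.Ioi (0 : ℝ), ENNReal.ofReal (ρ ^ 2 * ‖g ρ‖ ^ 2) = ⊤
  · rw [hB, ENNReal.mul_top (by simpa using hcε'), add_top]
    exact le_top
  have ha : IntegrableOn (fun ρ : ℝ => ρ ^ 2 * ‖deriv g ρ‖ ^ 2) (Set.Ioi 0) :=
    (lintegral_ofReal_ne_top_iff_integrable (by fun_prop)
      (Filter.Eventually.of_forall fun ρ => by simp only [Pi.zero_apply]; positivity)).1 hA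
  have hb : IntegrableOn (fun ρ : ℝ => ρ ^ 2 * ‖g ρ‖ ^ 2) (Set.Ioi 0) :=
    (lintegral_ofReal_ne_top_iff_integrable (by fun_prop)
      (Filter.Eventually.of_forall fun ρ => by simp only [Pi.zero_apply]; positivity)).1 hB
  have hc : Continuous fun ρ : ℝ => ρ * ‖g ρ‖ ^ 2 := by fun_prop
  set C := ∫ ρ in Set.Ioi (0 : ℝ), (ε / 2 * (ρ ^ 2 * ‖deriv g ρ‖ ^ 2) +
        1 / (2 * ε) * (ρ ^ 2 * ‖g ρ‖ ^ 2)) with hC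
  have hbound {R : ℝ} (hR : 0 ≤ R) : ∫ ρ in (0 : ℝ)..R, ρ * ‖g ρ‖ ^ 2 ≤ C := by
    refine le_of_forall_pos_le_add fun δ hδ => ?_
    obtain ⟨S, hRS, hS⟩ := exists_ge_le_of_integrableOn_Ioi hb hδ hR
    have h1 := intervalIntegral_mul_norm_sq_le hg hε ha hb (hR.trans hRS)
    have h2 : ∫ ρ in (0 : ℝ)..R, ρ * ‖g ρ‖ ^ 2 ≤ ∫ ρ in (0 : ℝ)..S, ρ * ‖g ρ‖ ^ 2 := by
      refine intervalIntegral.integral_mono_interval le_rfl hR hRS ?_ (hc.intervalIntegrable _ _)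
      filter_upwards [ae_restrict_mem measurableSet_Ioc] with ρ hρ
      exact mul_nonneg hρ.1.le (by positivity)
    linarith
  have hint : IntegrableOn (fun ρ : ℝ => ρ * ‖g ρ‖ ^ 2) (Set.Ioi 0) := by
    refine integrableOn_Ioi_of_intervalIntegral_norm_bounded C 0
      (fun R : ℝ => hc.integrableOn_Ioc) Filter.tendsto_id ?_
    filter_upwards [Filter.eventually_ge_atTop 0] with R hR
    refine le_trans (le_of_eq ?_) (hbound hR)
    refine intervalIntegral.integral_congr fun ρ hρ => ?_
    rw [id, Set.uIcc_of_le hR] at hρ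
    exact Real.norm_of_nonneg (mul_nonneg hρ.1 (by positivity))
  have hle : ∫ ρ in Set.Ioi (0 : ℝ), ρ * ‖g ρ‖ ^ 2 ≤ C := by
    refine le_of_tendsto (intervalIntegral_tendsto_integral_Ioi 0 hint Filter.tendsto_id) ?_
    filter_upwards [Filter.eventually_ge_atTop 0] with R hR using hbound hR
  rw [integral_add (ha.const_mul _) (hb.const_mul _), integral_const_mul, integral_const_mul] at hC
  rw [← ofReal_integral_eq_lintegral_ofReal hint, ← ofReal_integral_eq_lintegral_ofReal ha,
    ← ofReal_integral_eq_lintegral_ofReal hb, ← ENNReal.ofReal_mul hcε.le,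
    ← ENNReal.ofReal_mul hcε'.le, ← ENNReal.ofReal_add, ← hC]
  · exact ENNReal.ofReal_le_ofReal hle
  · exact mul_nonneg hcε.le (integral_nonneg fun ρ => by positivity)
  · exact mul_nonneg hcε'.le (integral_nonneg fun ρ => by positivity)
  · exact Filter.Eventually.of_forall fun ρ => by simp only [Pi.zero_apply]; positivity
  · exact Filter.Eventually.of_forall fun ρ => by simp only [Pi.zero_apply]; positivity
  · filter_upwards [ae_restrict_mem measurableSet_Ioi] with ρ hρ
    exact mul_nonneg (le_of_lt hρ) (by positivity)

/-- Integration in polar coordinates. -/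
theorem lintegral_eq_lintegral_toSphere {E : Type*} [NormedAddCommGroup E] [NormedSpace ℝ E]
    [MeasurableSpace E] [BorelSpace E] [FiniteDimensional ℝ E] [Nontrivial E]
    (μ : Measure E) [μ.IsAddHaarMeasure] {F : E → ENNReal} (hF : Measurable F) :
    ∫⁻ x, F x ∂μ = ∫⁻ ω, (∫⁻ ρ in Set.Ioi (0 : ℝ),
      ENNReal.ofReal (ρ ^ (Module.finrank ℝ E - 1)) * F (ρ • (ω : E))) ∂μ.toSphere := by
  have hF' : Measurable fun p : Metric.sphere (0 : E) 1 × Set.Ioi (0 : ℝ) =>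
      F ((p.2 : ℝ) • (p.1 : E)) := by fun_prop
  calc
    ∫⁻ x, F x ∂μ = ∫⁻ x : ({0}ᶜ : Set E), F x ∂(μ.comap (↑)) := by
      rw [lintegral_subtype_comap (measurableSet_singleton _).compl, restrict_compl_singleton]
    _ = ∫⁻ p, F ((p.2 : ℝ) • (p.1 : E))
        ∂μ.toSphere.prod (.volumeIoiPow (Module.finrank ℝ E - 1)) := by
      rw [← μ.measurePreserving_homeomorphUnitSphereProd.lintegral_comp hF']
      refine lintegral_congr fun x => ?_
      congr 1
      exact congrArg Subtype.val ((homeomorphUnitSphereProd E).symm_apply_apply x).symm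
    _ = _ := by
      rw [lintegral_prod _ hF'.aemeasurable]
      refine lintegral_congr fun ω => ?_
      rw [Measure.volumeIoiPow, lintegral_withDensity_eq_lintegral_mul _ (by fun_prop)
        (by fun_prop)]
      exact lintegral_subtype_comap measurableSet_Ioi
        fun ρ : ℝ => ENNReal.ofReal (ρ ^ (Module.finrank ℝ E - 1)) * F (ρ • (ω : E))

/-- Directional derivatives of a jointly measurable family of differentiable functions, along
measurable base points and directions, are measurable. -/
theorem measurable_fderiv_apply_of_param {E G α : Type*} [NormedAddCommGroup E] [NormedSpace ℝ E]
    [MeasurableSpace E] [BorelSpace E] [SecondCountableTopology E]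
    [NormedAddCommGroup G] [NormedSpace ℝ G]
    [MeasurableSpace G] [BorelSpace G] [SecondCountableTopology G]
    [MeasurableSpace α] {F : E → α → G} (hF : Measurable (Function.uncurry F))
    (hdiff : ∀ x, Differentiable ℝ fun r => F r x) {p u : α → E}
    (hp : Measurable p) (hu : Measurable u) :
    Measurable fun x => fderiv ℝ (fun r => F r x) (p x) (u x) := by
  refine measurable_of_tendsto_metrizable
    (f := fun (n : ℕ) x => (n : ℝ) • (F (p x + (n : ℝ)⁻¹ • u x) x - F (p x) x)) (fun n => ?_) ?_
  · have h1 : Measurable fun x => F (p x + (n : ℝ)⁻¹ • u x) x :=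
      hF.comp ((hp.add (hu.const_smul _)).prodMk measurable_id)
    have h2 : Measurable fun x => F (p x) x := hF.comp (hp.prodMk measurable_id)
    exact (h1.sub h2).const_smul _
  · refine tendsto_pi_nhds.2 fun x => ?_
    refine (hdiff x (p x)).hasFDerivAt.lim (u x) (c := fun n : ℕ => (n : ℝ)) ?_
    simpa using tendsto_natCast_atTop_atTop (R := ℝ)

/-- The hydrogen bound, with only the derivative in the radial direction around `a`. -/
theorem lintegral_norm_sq_div_dist_le {f : E3 → ℂ} (hf : Differentiable ℝ f) (a : E3)
    {ε : ℝ} (hε : 0 < ε) :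
    ∫⁻ r, ENNReal.ofReal (‖f r‖ ^ 2 / dist r a) ≤
      ENNReal.ofReal (ε / 2) *
          (∫⁻ r, ENNReal.ofReal (‖fderiv ℝ f r (‖r - a‖⁻¹ • (r - a))‖ ^ 2)) +
        ENNReal.ofReal (1 / (2 * ε)) * ∫⁻ r, ENNReal.ofReal (‖f r‖ ^ 2) := by
  have hfc : Continuous f := hf.continuous
  have hD : Measurable fun r => fderiv ℝ f r (‖r - a‖⁻¹ • (r - a)) :=
    measurable_fderiv_apply_of_param (F := fun r (_ : E3) => f r)
      (hfc.measurable.comp measurable_fst) (fun _ => hf) measurable_id (by fun_prop)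
  have polar {F : E3 → ENNReal} (hF : Measurable F) : ∫⁻ r, F r =
      ∫⁻ ω, (∫⁻ ρ in Set.Ioi (0 : ℝ), ENNReal.ofReal (ρ ^ 2) * F (ρ • (ω : E3) + a))
        ∂(volume : Measure E3).toSphere := by
    rw [← lintegral_add_right_eq_self F a]
    simpa using lintegral_eq_lintegral_toSphere volume (hF.comp (measurable_add_const a))
  have hmeas {F : E3 → ENNReal} (hF : Measurable F) :
      Measurable fun ω : Metric.sphere (0 : E3) 1 =>
        ∫⁻ ρ in Set.Ioi (0 : ℝ), ENNReal.ofReal (ρ ^ 2) * F (ρ • (ω : E3) + a) :=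
    Measurable.lintegral_prod_right' (f := fun q : Metric.sphere (0 : E3) 1 × ℝ =>
      ENNReal.ofReal (q.2 ^ 2) * F (q.2 • (q.1 : E3) + a)) (by fun_prop)
  have hm1 : Measurable fun r => ENNReal.ofReal (‖f r‖ ^ 2 / dist r a) :=
    ((hfc.norm.pow 2).measurable.div (by fun_prop)).ennreal_ofReal
  have hm2 : Measurable fun r =>
      ENNReal.ofReal (‖fderiv ℝ f r (‖r - a‖⁻¹ • (r - a))‖ ^ 2) :=
    (hD.norm.pow_const 2).ennreal_ofReal
  have hm3 : Measurable fun r => ENNReal.ofReal (‖f r‖ ^ 2) :=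
    (hfc.norm.pow 2).measurable.ennreal_ofReal
  rw [polar hm1, polar hm2, polar hm3, ← lintegral_const_mul _ (hmeas hm2),
    ← lintegral_const_mul _ (hmeas hm3), ← lintegral_add_left ((hmeas hm2).const_mul _)]
  refine lintegral_mono fun ω => ?_
  have hω : ‖(ω : E3)‖ = 1 := by simp
  have hg (ρ : ℝ) : HasDerivAt (fun ρ : ℝ => f (ρ • (ω : E3) + a))
      (fderiv ℝ f (ρ • (ω : E3) + a) (ω : E3)) ρ := by
    have h : HasDerivAt (fun ρ : ℝ => ρ • (ω : E3) + a) (ω : E3) ρ := by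
      simpa using ((hasDerivAt_id ρ).smul_const (ω : E3)).add_const a
    exact (hf _).hasFDerivAt.comp_hasDerivAt ρ h
  convert lintegral_Ioi_mul_norm_sq_le (fun ρ => (hg ρ).differentiableAt) hε using 1
  · refine setLIntegral_congr_fun measurableSet_Ioi fun ρ (hρ : 0 < ρ) => ?_
    rw [← ENNReal.ofReal_mul (by positivity)]
    congr 1
    simp only [dist_eq_norm, add_sub_cancel_right, norm_smul, hω, Real.norm_of_nonneg hρ.le]
    field_simp
  congr 2
  · refine setLIntegral_congr_fun measurableSet_Ioi fun ρ (hρ : 0 < ρ) => ?_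
    rw [← ENNReal.ofReal_mul (by positivity), (hg ρ).deriv]
    simp only [add_sub_cancel_right, norm_smul, hω, Real.norm_of_nonneg hρ.le, mul_one,
      inv_smul_smul₀ hρ.ne']
  · refine setLIntegral_congr_fun measurableSet_Ioi fun ρ _ => ?_
    rw [← ENNReal.ofReal_mul (by positivity)]

/-- Exchange bound via the hydrogen estimate: for a nonnegative operator `γ` with square
root kernel `k = γ^{1/2}(r,r')` and any `ε > 0`,
`X(γ^{1/2}) = (1/2)∬ |k(r,r')|²/|r-r'| ≤ (ε/4) Tr(-∇²γ) + (1/(4ε)) Tr γ`. -/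
theorem exchange_bound (k : E3 → E3 → ℂ)
    (hherm : ∀ r r', k r r' = starRingEnd ℂ (k r' r))
    (hpos : ∀ f : E3 → ℂ,
      0 ≤ (∫ p : E3 × E3, starRingEnd ℂ (f p.1) * k p.1 p.2 * f p.2).re)
    (hdiff : ∀ r', Differentiable ℝ (fun r => k r r'))
    (ε : ℝ) (hε : 0 < ε) :
    (∫⁻ p : E3 × E3, ENNReal.ofReal (‖k p.1 p.2‖ ^ 2 / dist p.1 p.2)) / 2 ≤
      ENNReal.ofReal (ε / 4) *
          (∫⁻ p : E3 × E3, ENNReal.ofReal (‖fderiv ℝ (fun r => k r p.2) p.1‖ ^ 2)) +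
        ENNReal.ofReal (1 / (4 * ε)) *
          ∫⁻ p : E3 × E3, ENNReal.ofReal (‖k p.1 p.2‖ ^ 2) := by
  have hk : Measurable (Function.uncurry k) := by
    refine measurable_uncurry_of_continuous_of_measurable (fun r' => (hdiff r').continuous)
      fun r => ?_
    have h : k r = fun r' => starRingEnd ℂ (k r' r) := funext fun r' => hherm r r'
    rw [h]
    exact (Complex.continuous_conj.comp (hdiff r).continuous).measurable
  have hk' : Measurable fun p : E3 × E3 => k p.1 p.2 := hk
  set D : E3 × E3 → ℂ := fun p =>
    fderiv ℝ (fun r => k r p.2) p.1 (‖p.1 - p.2‖⁻¹ • (p.1 - p.2))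
  have hD : Measurable D :=
    measurable_fderiv_apply_of_param (F := fun r (p : E3 × E3) => k r p.2)
      (hk.comp (measurable_fst.prodMk measurable_snd.snd)) (fun p => hdiff p.2)
      measurable_fst (by fun_prop)
  have hm1 : Measurable fun p : E3 × E3 => ENNReal.ofReal (‖k p.1 p.2‖ ^ 2 / dist p.1 p.2) := by
    fun_prop
  have hm2 : Measurable fun p : E3 × E3 => ENNReal.ofReal (‖D p‖ ^ 2) := by fun_prop
  have hm3 : Measurable fun p : E3 × E3 => ENNReal.ofReal (‖k p.1 p.2‖ ^ 2) := by fun_prop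
  have hDle : ∫⁻ p, ENNReal.ofReal (‖D p‖ ^ 2) ≤
      ∫⁻ p : E3 × E3, ENNReal.ofReal (‖fderiv ℝ (fun r => k r p.2) p.1‖ ^ 2) := by
    refine lintegral_mono fun p => ENNReal.ofReal_le_ofReal ?_
    gcongr
    refine ContinuousLinearMap.unit_le_opNorm _ _ ?_
    rw [norm_smul, norm_inv, norm_norm]
    exact inv_mul_le_one
  have main : ∫⁻ p : E3 × E3, ENNReal.ofReal (‖k p.1 p.2‖ ^ 2 / dist p.1 p.2) ≤
      ENNReal.ofReal (ε / 2) * (∫⁻ p, ENNReal.ofReal (‖D p‖ ^ 2)) +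
        ENNReal.ofReal (1 / (2 * ε)) * ∫⁻ p : E3 × E3, ENNReal.ofReal (‖k p.1 p.2‖ ^ 2) := by
    rw [Measure.volume_eq_prod, lintegral_prod_symm' _ hm1, lintegral_prod_symm' _ hm2,
      lintegral_prod_symm' _ hm3, ← lintegral_const_mul _ hm2.lintegral_prod_left',
      ← lintegral_const_mul _ hm3.lintegral_prod_left',
      ← lintegral_add_left (hm2.lintegral_prod_left'.const_mul _)]
    exact lintegral_mono fun r' => lintegral_norm_sq_div_dist_le (hdiff r') r' hε
  have half (c : ℝ) : ENNReal.ofReal (c / 2) = ENNReal.ofReal c / 2 := by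
    rw [ENNReal.ofReal_div_of_pos two_pos, ENNReal.ofReal_ofNat]
  rw [show ε / 4 = ε / 2 / 2 by ring, show 1 / (4 * ε) = 1 / (2 * ε) / 2 by field_simp; norm_num,
    half (ε / 2), half (1 / (2 * ε))]
  calc
    _ ≤ (ENNReal.ofReal (ε / 2) * (∫⁻ p, ENNReal.ofReal (‖D p‖ ^ 2)) +
        ENNReal.ofReal (1 / (2 * ε)) *
          ∫⁻ p : E3 × E3, ENNReal.ofReal (‖k p.1 p.2‖ ^ 2)) / 2 := by gcongr
    _ = ENNReal.ofReal (ε / 2) / 2 * (∫⁻ p, ENNReal.ofReal (‖D p‖ ^ 2)) +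
        ENNReal.ofReal (1 / (2 * ε)) / 2 *
          ∫⁻ p : E3 × E3, ENNReal.ofReal (‖k p.1 p.2‖ ^ 2) := by
      simp only [div_eq_mul_inv]
      ring
    _ ≤ _ := by gcongr

end
end
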